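/- arXiv:1211.6489 — 11 statements merged into one kernel-verified Lean document; each statement's English description precedes it below -/
import Mathlib

section
/- Let X be a normed linear space over the field K (real or complex) and let x₀ ∈ X with ‖x₀‖ = 1. If there exists a Hamel basis of X containing x₀ which is strongly orthonormal relative to x₀ in the sense of Birkhoff–James, then x₀ is an extreme point of the closed unit ball B_X = {x ∈ X : ‖x‖ ≤ 1}. -/
open scoped BigOperators

/-- `B` is a Hamel basis of the `𝕜`-vector space `X`. -/
def IsHamelBasis (𝕜 : Type*) [DivisionRing 𝕜] {X : Type*} [AddCommGroup X] [Module 𝕜 X]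
    (B : Set X) : Prop :=
  LinearIndependent 𝕜 ((↑) : B → X) ∧ Submodule.span 𝕜 B = ⊤

/-- The set `B` is strongly orthonormal relative to `x₀` in the sense of Birkhoff–James:
every element of `B` has norm one, and for every finite subset of `B \ {x₀}` and scalars
not all zero, `‖x₀ + ∑ λⱼ xⱼ‖ > ‖x₀‖`. -/
def IsStronglyOrthonormalRelTo (𝕜 : Type*) [RCLike 𝕜] {X : Type*} [NormedAddCommGroup X]
    [NormedSpace 𝕜 X] (B : Set X) (x₀ : X) : Prop :=
  (∀ y ∈ B, ‖y‖ = 1) ∧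
  ∀ (s : Finset X) (c : X → 𝕜), (s : Set X) ⊆ B \ {x₀} → (∃ y ∈ s, c y ≠ 0) →
    ‖x₀‖ < ‖x₀ + ∑ y ∈ s, c y • y‖

/-- `x₀` is an extreme point of the closed unit ball of `X`. -/
def IsExtremePointOfBall (𝕜 : Type*) [RCLike 𝕜] {X : Type*} [NormedAddCommGroup X]
    [NormedSpace 𝕜 X] (x₀ : X) : Prop :=
  ‖x₀‖ ≤ 1 ∧ ∀ z₁ z₂ : X, ‖z₁‖ ≤ 1 → ‖z₂‖ ≤ 1 → ∀ t : ℝ, 0 < t → t < 1 →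
    x₀ = ((t : 𝕜) • z₁ + (((1 - t : ℝ) : 𝕜)) • z₂) → z₁ = x₀ ∧ z₂ = x₀

/-- `x₀` is an exposed point of the closed unit ball of `X`: there is a supporting
hyperplane `H = {z : f z = 1}` (with `f` a norm-one continuous linear functional and
`f x₀ = 1`) meeting the ball only at `x₀`. -/
def IsExposedPointOfBall (𝕜 : Type*) [RCLike 𝕜] {X : Type*} [NormedAddCommGroup X]
    [NormedSpace 𝕜 X] (x₀ : X) : Prop :=
  ‖x₀‖ ≤ 1 ∧ ∃ f : X →L[𝕜] 𝕜, ‖f‖ = 1 ∧ f x₀ = 1 ∧ ∀ z : X, ‖z‖ ≤ 1 → f z = 1 → z = x₀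

/-- `X` is strictly convex: every element of the unit sphere is an extreme point of the
closed unit ball. -/
def IsStrictlyConvexSpace (𝕜 : Type*) [RCLike 𝕜] (X : Type*) [NormedAddCommGroup X]
    [NormedSpace 𝕜 X] : Prop :=
  ∀ x : X, ‖x‖ = 1 → IsExtremePointOfBall 𝕜 x

/-- The coordinate functional at `x₀` of a strongly orthonormal Hamel basis is normalized at
`x₀`, and its nonzero kernel elements strictly increase the norm of `x₀`. -/
theorem IsStronglyOrthonormalRelTo.exists_coord {𝕜 X : Type*} [RCLike 𝕜]
    [NormedAddCommGroup X] [NormedSpace 𝕜 X] {B : Set X} {x₀ : X} (hmem : x₀ ∈ B)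
    (hB : IsHamelBasis 𝕜 B) (hs : IsStronglyOrthonormalRelTo 𝕜 B x₀) :
    ∃ f : X →ₗ[𝕜] 𝕜, f x₀ = 1 ∧ ∀ w, f w = 0 → w ≠ 0 → ‖x₀‖ < ‖x₀ + w‖ := by
  let b : Module.Basis B 𝕜 X := .mk hB.1 (by simp [hB.2])
  have hb : ∀ y : B, b y = y := fun y => by simp [b]
  refine ⟨b.coord ⟨x₀, hmem⟩, ?_, fun w hw hne => ?_⟩
  · have := congrArg (b.coord ⟨x₀, hmem⟩) (hb ⟨x₀, hmem⟩)
    simpa using this.symm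
  · have hc : ∀ y : B, Function.extend Subtype.val (b.repr w) 0 (y : X) = b.repr w y :=
      fun y => Subtype.val_injective.extend_apply _ _ y
    have hsum : ∑ y ∈ (b.repr w).support.map (Function.Embedding.subtype _),
        Function.extend Subtype.val (b.repr w) 0 y • y = w := by
      rw [Finset.sum_map]
      conv_rhs => rw [← b.linearCombination_repr w, Finsupp.linearCombination_apply]
      exact Finset.sum_congr rfl fun y _ => by simp [hb]
    rw [← hsum]
    apply hs.2
    · intro y hy
      obtain ⟨z, hz, rfl⟩ := Finset.mem_map.1 (Finset.mem_coe.1 hy)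
      refine ⟨z.2, fun h => Finsupp.mem_support_iff.1 hz ?_⟩
      rwa [show z = ⟨x₀, hmem⟩ from Subtype.ext h]
    · obtain ⟨y, hy⟩ := Finsupp.support_nonempty_iff.2
        (b.repr.map_ne_zero_iff.2 hne)
      exact ⟨y, Finset.mem_map_of_mem _ hy, by
        rw [hc]; exact Finsupp.mem_support_iff.1 hy⟩

/-- A linear functional normalized at `x₀`, whose kernel elements do not decrease the norm of
the unit vector `x₀`, is bounded by the norm. -/
theorem norm_apply_le_of_norm_le_norm_add_ker {𝕜 X : Type*} [RCLike 𝕜]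
    [NormedAddCommGroup X] [NormedSpace 𝕜 X] {x₀ : X} (hx₀ : ‖x₀‖ = 1) {f : X →ₗ[𝕜] 𝕜}
    (hf : f x₀ = 1) (hker : ∀ w, f w = 0 → ‖x₀‖ ≤ ‖x₀ + w‖) (z : X) : ‖f z‖ ≤ ‖z‖ := by
  rcases eq_or_ne (f z) 0 with h | h
  · simp [h]
  have := hker ((f z)⁻¹ • z - x₀) (by simp [hf, h])
  rw [add_sub_cancel, norm_smul, norm_inv, hx₀] at this
  have hpos := norm_pos_iff.2 h
  calc ‖f z‖ ≤ ‖f z‖ * (‖f z‖⁻¹ * ‖z‖) := le_mul_of_one_le_right hpos.le this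
    _ = ‖z‖ := by field_simp

/-- An element of norm at most one and real part one equals one. -/
theorem RCLike.eq_one_of_norm_le_one_of_re_eq_one {𝕜 : Type*} [RCLike 𝕜] {a : 𝕜}
    (ha : ‖a‖ ≤ 1) (hre : RCLike.re a = 1) : a = 1 := by
  have h := RCLike.norm_sq_eq_def (z := a)
  rw [hre] at h
  have him : RCLike.im a = 0 := by
    nlinarith [norm_nonneg a, sq_nonneg (RCLike.im a)]
  exact RCLike.ext (by simp [hre]) (by simp [him])

/-- If there exists a Hamel basis of `X` containing `x₀` which is strongly orthonormal
relative to `x₀` in the sense of Birkhoff–James, then the unit vector `x₀` is an extreme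
point of the closed unit ball. -/
theorem extremePoint_of_stronglyOrthonormalBasis
    (𝕜 X : Type*) [RCLike 𝕜] [NormedAddCommGroup X] [NormedSpace 𝕜 X]
    (x₀ : X) (hx₀ : ‖x₀‖ = 1)
    (h : ∃ B : Set X, x₀ ∈ B ∧ IsHamelBasis 𝕜 B ∧ IsStronglyOrthonormalRelTo 𝕜 B x₀) :
    IsExtremePointOfBall 𝕜 x₀ := by
  obtain ⟨B, hmem, hB, hs⟩ := h
  obtain ⟨f, hf, hker⟩ := hs.exists_coord hmem hB
  have hle := norm_apply_le_of_norm_le_norm_add_ker hx₀ hf fun w hw => by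
    rcases eq_or_ne w 0 with rfl | hne
    · simp
    · exact (hker w hw hne).le
  have huniq : ∀ z : X, ‖z‖ ≤ 1 → RCLike.re (f z) = 1 → z = x₀ := by
    intro z hz hre
    have h1 := RCLike.eq_one_of_norm_le_one_of_re_eq_one ((hle z).trans hz) hre
    by_contra hne
    have := hker (z - x₀) (by simp [h1, hf]) (sub_ne_zero.2 hne)
    rw [add_sub_cancel, hx₀] at this
    exact this.not_ge hz
  refine ⟨hx₀.le, fun z₁ z₂ h₁ h₂ t ht ht' heq => ?_⟩
  have hre : 1 = t * RCLike.re (f z₁) + (1 - t) * RCLike.re (f z₂) := by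
    have := congrArg (fun z => RCLike.re (f z)) heq
    simpa only [map_add, map_smul, smul_eq_mul, RCLike.re_ofReal_mul, hf, RCLike.one_re]
      using this
  have hr₁ := (RCLike.re_le_norm (f z₁)).trans ((hle z₁).trans h₁)
  have hr₂ := (RCLike.re_le_norm (f z₂)).trans ((hle z₂).trans h₂)
  exact ⟨huniq z₁ h₁ (by nlinarith), huniq z₂ h₂ (by nlinarith)⟩
end

section
/- In ℝ³ equipped with the supremum norm, the set {(1,1,1), (1,0,−1), (0,1,−1)} is a Hamel basis of ℝ³ which is strongly orthonormal relative to (1,1,1) in the sense of Birkhoff–James: each of the three vectors has sup norm 1, the three vectors are linearly independent, and ‖(1,1,1) + λ₁(1,0,−1) + λ₂(0,1,−1)‖_∞ > 1 whenever (λ₁,λ₂) ≠ (0,0). -/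
open scoped BigOperators

theorem linearIndependent_linfty_three_example :
    LinearIndependent ℝ ![(![1, 1, 1] : Fin 3 → ℝ), ![1, 0, -1], ![0, 1, -1]] := by
  rw [Fintype.linearIndependent_iff]
  intro g hg
  have h0 := congrFun hg 0
  have h1 := congrFun hg 1
  have h2 := congrFun hg 2
  simp [Fin.sum_univ_three] at h0 h1 h2
  intro i
  fin_cases i <;> simp <;> linarith

theorem isHamelBasis_linfty_three_example :
    IsHamelBasis ℝ ({![1, 1, 1], ![1, 0, -1], ![0, 1, -1]} : Set (Fin 3 → ℝ)) := by
  constructor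
  · have h := linearIndependent_linfty_three_example.linearIndepOn_id
    have hr : Set.range ![(![1, 1, 1] : Fin 3 → ℝ), ![1, 0, -1], ![0, 1, -1]] =
        {![1, 1, 1], ![1, 0, -1], ![0, 1, -1]} := by
      simp only [Matrix.range_cons, Matrix.range_empty, Set.union_empty, Set.singleton_union]
    rw [hr] at h
    exact h
  · rw [eq_top_iff]
    intro v _
    rw [Submodule.mem_span_triple]
    refine ⟨(v 0 + v 1 + v 2) / 3, v 0 - (v 0 + v 1 + v 2) / 3,
      v 1 - (v 0 + v 1 + v 2) / 3, ?_⟩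
    ext i
    fin_cases i <;> simp
    ring

theorem one_lt_norm_linfty_three_example (a b : ℝ) (h : ¬ (a = 0 ∧ b = 0)) :
    1 < ‖(![1, 1, 1] : Fin 3 → ℝ) + a • ![1, 0, -1] + b • ![0, 1, -1]‖ := by
  by_contra! hle
  rw [pi_norm_le_iff_of_nonneg zero_le_one] at hle
  have h0 := (abs_le.mp (hle 0)).2
  have h1 := (abs_le.mp (hle 1)).2
  have h2 := (abs_le.mp (hle 2)).2
  simp at h0 h1 h2
  exact h ⟨by linarith, by linarith⟩

/-- The sup norm of a vector of `ℝ³` with entries in `[-1, 1]` and some entry `1` is one. -/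
theorem norm_fin_three_eq_one {v : Fin 3 → ℝ} (h : ∀ i, |v i| ≤ 1) {j : Fin 3} (hj : v j = 1) :
    ‖v‖ = 1 := by
  refine le_antisymm ((pi_norm_le_iff_of_nonneg zero_le_one).2 h) ?_
  simpa [hj] using norm_le_pi_norm v j

theorem isStronglyOrthonormalRelTo_linfty_three_example :
    IsStronglyOrthonormalRelTo ℝ
      ({![1, 1, 1], ![1, 0, -1], ![0, 1, -1]} : Set (Fin 3 → ℝ)) ![1, 1, 1] := by
  have hx : ‖(![1, 1, 1] : Fin 3 → ℝ)‖ = 1 :=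
    norm_fin_three_eq_one (j := 0) (by intro i; fin_cases i <;> simp) rfl
  refine ⟨?_, fun s c hs hc => ?_⟩
  · rintro y (rfl | rfl | rfl)
    · exact hx
    · exact norm_fin_three_eq_one (j := 0) (by intro i; fin_cases i <;> simp) rfl
    · exact norm_fin_three_eq_one (j := 1) (by intro i; fin_cases i <;> simp) rfl
  · classical
    have hne : (![1, 0, -1] : Fin 3 → ℝ) ≠ ![0, 1, -1] := fun h => by
      simpa using congrFun h 0
    have hsub : s ⊆ {![1, 0, -1], ![0, 1, -1]} := by
      intro y hy
      obtain ⟨h | h, hn⟩ := hs hy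
      · exact absurd h hn
      · simpa using h
    have hsum : ∑ y ∈ s, c y • y =
        ∑ y ∈ ({![1, 0, -1], ![0, 1, -1]} : Finset (Fin 3 → ℝ)),
          (if y ∈ s then c y else 0) • y := by
      rw [← Finset.sum_subset hsub (fun y _ hy => by simp [hy])]
      exact Finset.sum_congr rfl fun y hy => by simp [hy]
    rw [hx, hsum, Finset.sum_pair hne, ← add_assoc]
    apply one_lt_norm_linfty_three_example
    rintro ⟨hv, hw⟩
    obtain ⟨y, hy, hcy⟩ := hc
    rcases Finset.mem_insert.mp (hsub hy) with rfl | h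
    · exact hcy (by rwa [if_pos hy] at hv)
    · obtain rfl := Finset.mem_singleton.mp h
      exact hcy (by rwa [if_pos hy] at hw)

/-- In `ℝ³` with the sup norm, `{(1,1,1), (1,0,-1), (0,1,-1)}` is a Hamel basis which is
strongly orthonormal relative to `(1,1,1)` in the sense of Birkhoff–James; in particular
all three vectors have sup norm one, they are linearly independent, and
`‖(1,1,1) + λ₁ (1,0,-1) + λ₂ (0,1,-1)‖_∞ > 1` whenever `(λ₁, λ₂) ≠ (0,0)`. -/
theorem linfty_three_stronglyOrthonormal_basis_example :
    IsHamelBasis ℝ ({![1, 1, 1], ![1, 0, -1], ![0, 1, -1]} : Set (Fin 3 → ℝ)) ∧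
    IsStronglyOrthonormalRelTo ℝ
      ({![1, 1, 1], ![1, 0, -1], ![0, 1, -1]} : Set (Fin 3 → ℝ)) ![1, 1, 1] ∧
    ∀ l₁ l₂ : ℝ, ¬ (l₁ = 0 ∧ l₂ = 0) →
      1 < ‖(![1, 1, 1] : Fin 3 → ℝ) + l₁ • ![1, 0, -1] + l₂ • ![0, 1, -1]‖ :=
  ⟨isHamelBasis_linfty_three_example, isStronglyOrthonormalRelTo_linfty_three_example,
    one_lt_norm_linfty_three_example⟩
end

section
/- Let X be a normed linear space over the field K (real or complex) and let x₀ ∈ X with ‖x₀‖ = 1 be an exposed point of the closed unit ball B_X. Then there exists a Hamel basis of X containing x₀ which is strongly orthonormal relative to x₀ in the sense of Birkhoff–James. -/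
open scoped BigOperators

/-- Every subspace of a normed space is spanned by a linearly independent set of unit vectors. -/
theorem Submodule.exists_linearIndepOn_id_norm_eq_one_span_eq {𝕜 X : Type*} [RCLike 𝕜]
    [NormedAddCommGroup X] [NormedSpace 𝕜 X] (V : Submodule 𝕜 X) :
    ∃ C : Set X, (∀ y ∈ C, y ∈ V ∧ ‖y‖ = 1) ∧ LinearIndepOn 𝕜 id C ∧
      Submodule.span 𝕜 C = V := by
  obtain ⟨C, hC, hspan, hli⟩ := exists_linearIndependent 𝕜 {y : X | y ∈ V ∧ ‖y‖ = 1}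
  refine ⟨C, fun y hy => hC hy, hli, hspan.trans (le_antisymm ?_ fun z hz => ?_)⟩
  · exact Submodule.span_le.2 fun y hy => hy.1
  · rcases eq_or_ne z 0 with rfl | hz0
    · exact Submodule.zero_mem _
    have hz' : (‖z‖ : 𝕜) ≠ 0 := by simpa using hz0
    rw [← smul_inv_smul₀ hz' z]
    exact Submodule.smul_mem _ _
      (Submodule.subset_span ⟨V.smul_mem _ hz, norm_smul_inv_norm hz0⟩)

/-- If the unit vector `x₀` is an exposed point of the closed unit ball, then there exists
a Hamel basis of `X` containing `x₀` which is strongly orthonormal relative to `x₀` in the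
sense of Birkhoff–James. -/
theorem stronglyOrthonormalBasis_of_exposedPoint
    (𝕜 X : Type*) [RCLike 𝕜] [NormedAddCommGroup X] [NormedSpace 𝕜 X]
    (x₀ : X) (hx₀ : ‖x₀‖ = 1) (h : IsExposedPointOfBall 𝕜 x₀) :
    ∃ B : Set X, x₀ ∈ B ∧ IsHamelBasis 𝕜 B ∧ IsStronglyOrthonormalRelTo 𝕜 B x₀ := by
  obtain ⟨-, f, -, hfx, hf⟩ := h
  obtain ⟨C, hC, hli, hspan⟩ := f.ker.exists_linearIndepOn_id_norm_eq_one_span_eq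
  have hker : ∀ y ∈ C, f y = 0 := fun y hy => (hC y hy).1
  have hx₀C : x₀ ∉ Submodule.span 𝕜 C := by
    rw [hspan, LinearMap.mem_ker]
    simp [hfx]
  refine ⟨insert x₀ C, Set.mem_insert _ _, ⟨hli.id_insert hx₀C, ?_⟩, ?_, ?_⟩
  · refine eq_top_iff.2 fun z _ => Submodule.mem_span_insert.2 ⟨f z, z - f z • x₀, ?_, by simp⟩
    rw [hspan, LinearMap.mem_ker]
    simp [hfx]
  · rintro y (rfl | hy)
    exacts [hx₀, (hC y hy).2]
  · rintro s c hs ⟨y, hy, hcy⟩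
    have hsC : (s : Set X) ⊆ C := fun z hz => (hs hz).1.resolve_left (hs hz).2
    by_contra! hle
    have hsum : ∑ z ∈ s, c z • z = 0 := by
      refine add_eq_left.1 (hf _ (hle.trans_eq hx₀) ?_)
      rw [map_add, map_sum, hfx, add_eq_left]
      exact Finset.sum_eq_zero fun z hz => by rw [map_smul, hker z (hsC hz), smul_zero]
    exact hcy (linearIndepOn_finset_iff.1 (hli.mono hsC) c hsum y hy)
end

section
/- Let X be a normed linear space over the field K (real or complex) and let x₀ ∈ X with ‖x₀‖ = 1. If there exists a Hamel basis of X containing x₀ which is strongly orthonormal relative to x₀ in the sense of Birkhoff–James, then there exists a bounded invertible linear operator A on X such that ‖A‖ = ‖A x₀‖ and ‖A x₀‖ > ‖A y‖ for all y with ‖y‖ = 1 and y ≠ λ x₀ for every scalar λ with |λ| = 1. -/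
open scoped BigOperators

/-- Adding to `x₀` a nonzero vector with vanishing `x₀`-coordinate increases the norm. -/
theorem IsStronglyOrthonormalRelTo.norm_lt_norm_add {𝕜 X : Type*} [RCLike 𝕜]
    [NormedAddCommGroup X] [NormedSpace 𝕜 X] {B : Set X} (b : Module.Basis B 𝕜 X)
    (hb : ∀ i, b i = i) {x₀ : X} (hx₀ : x₀ ∈ B) (hB : IsStronglyOrthonormalRelTo 𝕜 B x₀)
    {v : X} (hv : v ≠ 0) (hv₀ : b.coord ⟨x₀, hx₀⟩ v = 0) : ‖x₀‖ < ‖x₀ + v‖ := by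
  classical
  set c : X → 𝕜 := Function.extend Subtype.val (b.repr v) 0
  have hc (i : B) : c i = b.repr v i := Subtype.val_injective.extend_apply _ _ i
  let s : Finset X := (b.repr v).support.map (Function.Embedding.subtype _)
  have hsum : ∑ y ∈ s, c y • y = v := by
    conv_rhs => rw [← b.linearCombination_repr v, Finsupp.linearCombination_apply, Finsupp.sum]
    simp [s, Finset.sum_map, hc, hb]
  rw [← hsum]
  refine hB.2 s c ?_ ?_
  · intro y hy
    obtain ⟨i, hi, rfl⟩ := Finset.mem_map.1 (Finset.mem_coe.1 hy)
    refine ⟨i.2, fun h => Finsupp.mem_support_iff.1 hi ?_⟩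
    obtain rfl : i = ⟨x₀, hx₀⟩ := Subtype.ext h
    exact hv₀
  · by_contra! hzero
    exact hv (hsum.symm.trans (Finset.sum_eq_zero fun y hy => by rw [hzero y hy, zero_smul]))

/-- The `x₀`-coordinate of `y` is strictly smaller than `‖y‖` unless `y` is a multiple of `x₀`. -/
theorem IsStronglyOrthonormalRelTo.norm_coord_lt {𝕜 X : Type*} [RCLike 𝕜]
    [NormedAddCommGroup X] [NormedSpace 𝕜 X] {B : Set X} (b : Module.Basis B 𝕜 X)
    (hb : ∀ i, b i = i) {x₀ : X} (hx₀ : x₀ ∈ B) (hB : IsStronglyOrthonormalRelTo 𝕜 B x₀)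
    {y : X} (hy : y ≠ b.coord ⟨x₀, hx₀⟩ y • x₀) : ‖b.coord ⟨x₀, hx₀⟩ y‖ < ‖y‖ := by
  set f := b.coord ⟨x₀, hx₀⟩
  have hf : f x₀ = 1 := by
    have h := b.repr_self ⟨x₀, hx₀⟩
    rw [hb] at h
    simp [f, h]
  by_cases h0 : f y = 0
  · rw [h0, zero_smul] at hy
    simpa [h0] using hy
  have hne : (f y)⁻¹ • y - x₀ ≠ 0 := fun h => hy <| by
    rw [← sub_eq_zero.1 h, smul_inv_smul₀ h0]
  have h := hB.norm_lt_norm_add b hb hx₀ hne (by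
    change f _ = 0
    simp [hf, h0])
  rw [add_sub_cancel, hB.1 x₀ hx₀, norm_smul, norm_inv, inv_mul_eq_div,
    one_lt_div (norm_pos_iff.2 h0)] at h
  exact h

/-- If there exists a Hamel basis of `X` containing the unit vector `x₀` which is strongly
orthonormal relative to `x₀` in the sense of Birkhoff–James, then there exists a bounded
invertible linear operator `A` on `X` with `‖A‖ = ‖A x₀‖ > ‖A y‖` for every unit vector
`y` not of the form `λ x₀` with `|λ| = 1`. -/
theorem exists_normAttaining_operator_of_stronglyOrthonormalBasis
    (𝕜 X : Type*) [RCLike 𝕜] [NormedAddCommGroup X] [NormedSpace 𝕜 X]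
    (x₀ : X) (hx₀ : ‖x₀‖ = 1)
    (h : ∃ B : Set X, x₀ ∈ B ∧ IsHamelBasis 𝕜 B ∧ IsStronglyOrthonormalRelTo 𝕜 B x₀) :
    ∃ A : X →L[𝕜] X, Function.Bijective A ∧ ‖A‖ = ‖A x₀‖ ∧
      ∀ y : X, ‖y‖ = 1 → (∀ lam : 𝕜, ‖lam‖ = 1 → y ≠ lam • x₀) → ‖A y‖ < ‖A x₀‖ := by
  obtain ⟨B, hxB, ⟨hli, hspan⟩, hB⟩ := h
  let b : Module.Basis B 𝕜 X := Module.Basis.mk hli (by simp [hspan])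
  have hb (i : B) : b i = i := Module.Basis.mk_apply _ _ i
  have hlt {y : X} := hB.norm_coord_lt (y := y) b hb hxB
  set f := b.coord ⟨x₀, hxB⟩
  have hf : f x₀ = 1 := by
    have h := b.repr_self ⟨x₀, hxB⟩
    rw [hb] at h
    simp [f, h]
  have hle (y : X) : ‖f y‖ ≤ 1 * ‖y‖ := by
    rw [one_mul]
    by_cases hy : y = f y • x₀
    · conv_rhs => rw [hy, norm_smul, hx₀, mul_one]
    · exact (hlt hy).le
  let F : X →L[𝕜] 𝕜 := f.mkContinuous 1 hle
  let A : X →L[𝕜] X := ContinuousLinearMap.id 𝕜 X + F.smulRight x₀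
  have hA (y : X) : A y = y + f y • x₀ := rfl
  have hAx : ‖A x₀‖ = 2 := by
    rw [hA, hf, one_smul, ← two_smul 𝕜 x₀, norm_smul, hx₀]
    simp
  have hAle (y : X) : ‖A y‖ ≤ ‖y‖ + ‖f y‖ := by
    simpa [hA, norm_smul, hx₀] using norm_add_le y (f y • x₀)
  refine ⟨A, ?_, le_antisymm ?_ ?_, fun y hy hne => ?_⟩
  · refine Function.bijective_iff_has_inverse.2 ⟨fun z => z - (f z / 2) • x₀, fun y => ?_,
      fun z => ?_⟩
    · simp only [hA, map_add, map_smul, hf, smul_eq_mul]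
      module
    · simp only [hA, map_sub, map_smul, hf, smul_eq_mul]
      module
  · rw [hAx]
    refine A.opNorm_le_bound zero_le_two fun y => ?_
    linarith [hAle y, hle y]
  · simpa [hx₀] using A.le_opNorm x₀
  · have hfy : ‖f y‖ < 1 := by
      by_cases h : y = f y • x₀
      · refine absurd h (hne _ ?_)
        rw [← hy]
        conv_rhs => rw [h, norm_smul, hx₀, mul_one]
      · exact hy ▸ hlt h
    linarith [hAle y]
end

section
/- Let X be a normed linear space over the field K (real or complex) and let x₀ ∈ X with ‖x₀‖ = 1. If there exists a bounded linear operator A : X → X which attains its norm (i.e., ‖A y‖ = ‖A‖ with ‖y‖ = 1) only at points of the form λ x₀ with λ a scalar of modulus 1, and A does attain its norm at x₀, then x₀ is an exposed point of the closed unit ball B_X. -/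
open scoped BigOperators

/-- A bounded operator attaining its norm at a unit vector `x₀` has a norm-one functional with
value one at `x₀`, such that the operator attains its norm wherever the functional does. -/
theorem exists_functional_of_normAttaining {𝕜 X Y : Type*} [RCLike 𝕜]
    [NormedAddCommGroup X] [NormedSpace 𝕜 X] [NormedAddCommGroup Y] [NormedSpace 𝕜 Y]
    {x₀ : X} (hx₀ : ‖x₀‖ = 1) (A : X →L[𝕜] Y) (hA : ‖A x₀‖ = ‖A‖) :
    ∃ f : X →L[𝕜] 𝕜, ‖f‖ = 1 ∧ f x₀ = 1 ∧
      ∀ z : X, ‖z‖ ≤ 1 → f z = 1 → ‖A z‖ = ‖A‖ := by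
  rcases eq_or_ne A 0 with rfl | hne
  · obtain ⟨f, hf, hfx⟩ := exists_dual_vector 𝕜 x₀ (by simp [hx₀])
    exact ⟨f, hf, by simpa [hx₀] using hfx, by simp⟩
  have hpos : 0 < ‖A‖ := norm_pos_iff.mpr hne
  obtain ⟨g, hg, hgx⟩ := exists_dual_vector 𝕜 (A x₀) (hA ▸ hpos.ne')
  have hgA (z : X) : ‖g (A z)‖ ≤ ‖A z‖ := by simpa [hg] using g.le_opNorm (A z)
  let f : X →L[𝕜] 𝕜 := ((‖A‖ : 𝕜)⁻¹) • g.comp A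
  have hfx : f x₀ = 1 := by simp [f, hgx, hA, hpos.ne']
  have hfz (z : X) : ‖f z‖ ≤ ‖A‖⁻¹ * ‖A z‖ := by
    simpa [f] using mul_le_mul_of_nonneg_left (hgA z) (inv_nonneg.mpr hpos.le)
  refine ⟨f, le_antisymm (f.opNorm_le_bound zero_le_one fun z => ?_) ?_, hfx, fun z hz hz1 => ?_⟩
  · calc ‖f z‖ ≤ ‖A‖⁻¹ * ‖A z‖ := hfz z
      _ ≤ ‖A‖⁻¹ * (‖A‖ * ‖z‖) := by gcongr; exact A.le_opNorm z
      _ = 1 * ‖z‖ := by field_simp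
  · simpa [hfx, hx₀] using f.le_opNorm x₀
  · refine le_antisymm (A.unit_le_opNorm z hz) ?_
    have h := hfz z
    rw [hz1, norm_one, inv_mul_eq_div, le_div_iff₀ hpos, one_mul] at h
    exact h

/-- If there is a bounded linear operator `A` on `X` attaining its norm at the unit vector
`x₀` and only at points of the form `λ x₀` with `|λ| = 1`, then `x₀` is an exposed point
of the closed unit ball. -/
theorem exposedPoint_of_normAttaining_operator
    (𝕜 X : Type*) [RCLike 𝕜] [NormedAddCommGroup X] [NormedSpace 𝕜 X]
    (x₀ : X) (hx₀ : ‖x₀‖ = 1) (A : X →L[𝕜] X)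
    (hAx₀ : ‖A x₀‖ = ‖A‖)
    (honly : ∀ y : X, ‖y‖ = 1 → ‖A y‖ = ‖A‖ → ∃ lam : 𝕜, ‖lam‖ = 1 ∧ y = lam • x₀) :
    IsExposedPointOfBall 𝕜 x₀ := by
  obtain ⟨f, hf, hfx, hfA⟩ := exists_functional_of_normAttaining hx₀ A hAx₀
  refine ⟨hx₀.le, f, hf, hfx, fun z hz hz1 => ?_⟩
  have hz_norm : ‖z‖ = 1 := le_antisymm hz (by simpa [hf, hz1] using f.le_opNorm z)
  obtain ⟨lam, -, rfl⟩ := honly z hz_norm (hfA z hz hz1)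
  have hlam : lam = 1 := by simpa [hfx] using hz1
  rw [hlam, one_smul]
end

section
/- Let X be a normed linear space over the field K (real or complex) and x ∈ X with ‖x‖ = 1. Then x is an exposed point of the closed unit ball B_X if and only if there exists a Hamel basis of X containing x which is strongly orthonormal relative to x in the sense of Birkhoff–James. -/
open scoped BigOperators

/-- Every submodule of a normed space is spanned by a linearly independent set of unit vectors. -/
theorem Submodule.exists_linearIndepOn_norm_eq_one_span_eq
    {𝕜 X : Type*} [RCLike 𝕜] [NormedAddCommGroup X] [NormedSpace 𝕜 X] (K : Submodule 𝕜 X) :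
    ∃ C : Set X, (∀ y ∈ C, ‖y‖ = 1) ∧ LinearIndepOn 𝕜 id C ∧ Submodule.span 𝕜 C = K := by
  obtain ⟨C, hCs, hspan, hli⟩ := exists_linearIndependent 𝕜 {y : X | y ∈ K ∧ ‖y‖ = 1}
  refine ⟨C, fun y hy => (hCs hy).2, hli, hspan.trans (le_antisymm ?_ ?_)⟩
  · exact Submodule.span_le.2 fun y hy => hy.1
  · intro y hy
    rcases eq_or_ne y 0 with rfl | hy0
    · exact zero_mem _
    · have hy' : (‖y‖ : 𝕜) ≠ 0 := by simpa using hy0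
      have hmem : (‖y‖ : 𝕜)⁻¹ • y ∈ Submodule.span 𝕜 {y : X | y ∈ K ∧ ‖y‖ = 1} :=
        Submodule.subset_span ⟨K.smul_mem _ hy, norm_smul_inv_norm hy0⟩
      simpa [smul_smul, hy'] using Submodule.smul_mem _ (‖y‖ : 𝕜) hmem

theorem IsStronglyOrthonormalRelTo.norm_lt_norm_add_s10
    {𝕜 X : Type*} [RCLike 𝕜] [NormedAddCommGroup X] [NormedSpace 𝕜 X] {B : Set X} {x m : X}
    (hB : IsStronglyOrthonormalRelTo 𝕜 B x) (hm : m ∈ Submodule.span 𝕜 (B \ {x}))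
    (hm0 : m ≠ 0) : ‖x‖ < ‖x + m‖ := by
  obtain ⟨c, hc, rfl⟩ := Submodule.mem_span_set.1 hm
  refine hB.2 c.support c hc ?_
  by_contra! h
  exact hm0 (Finset.sum_eq_zero fun y hy => by simp [h y hy])

theorem IsExposedPointOfBall.exists_stronglyOrthonormal
    {𝕜 X : Type*} [RCLike 𝕜] [NormedAddCommGroup X] [NormedSpace 𝕜 X] {x : X} (hx : ‖x‖ = 1)
    (h : IsExposedPointOfBall 𝕜 x) :
    ∃ B : Set X, x ∈ B ∧ IsHamelBasis 𝕜 B ∧ IsStronglyOrthonormalRelTo 𝕜 B x := by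
  obtain ⟨-, f, -, hfx, hexp⟩ := h
  obtain ⟨C, hC1, hli, hspan⟩ :=
    Submodule.exists_linearIndepOn_norm_eq_one_span_eq (LinearMap.ker (f : X →ₗ[𝕜] 𝕜))
  have hker : ∀ z, z ∈ Submodule.span 𝕜 C ↔ f z = 0 := fun z => by simp [hspan]
  refine ⟨insert x C, Set.mem_insert _ _, ⟨?_, ?_⟩, ?_, ?_⟩
  · exact hli.id_insert (by simp [hker, hfx])
  · refine Submodule.eq_top_iff'.2 fun z => Submodule.mem_span_insert.2
      ⟨f z, z - f z • x, (hker _).2 (by simp [hfx]), by simp⟩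
  · rintro y (rfl | hy)
    exacts [hx, hC1 y hy]
  · rintro s c hs ⟨y, hy, hcy⟩
    have hsC : (s : Set X) ⊆ C := fun z hz => (hs hz).1.resolve_left (hs hz).2
    have hf : f (∑ y ∈ s, c y • y) = 0 := (hker _).1 <|
      Submodule.sum_mem _ fun z hz => Submodule.smul_mem _ _ (Submodule.subset_span (hsC hz))
    by_contra! hle
    have hsum : ∑ y ∈ s, c y • y = 0 := by
      simpa using hexp _ (hle.trans hx.le) (by rw [map_add, hf, hfx, add_zero])
    exact hcy (linearIndepOn_finset_iff.1 (hli.mono hsC) c hsum y hy)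

theorem IsStronglyOrthonormalRelTo.isExposedPointOfBall
    {𝕜 X : Type*} [RCLike 𝕜] [NormedAddCommGroup X] [NormedSpace 𝕜 X] {B : Set X} {x : X}
    (hB : IsStronglyOrthonormalRelTo 𝕜 B x) (hxB : x ∈ B) (hbasis : IsHamelBasis 𝕜 B) :
    IsExposedPointOfBall 𝕜 x := by
  have hx : ‖x‖ = 1 := hB.1 x hxB
  let b : Module.Basis B 𝕜 X := Module.Basis.mk hbasis.1 (by simp [hbasis.2])
  have hbx : b ⟨x, hxB⟩ = x := by simp [b]
  let g : X →ₗ[𝕜] 𝕜 := b.coord ⟨x, hxB⟩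
  have hgx : g x = 1 := by
    have : g (b ⟨x, hxB⟩) = 1 := by simp [g]
    rwa [hbx] at this
  have hker : ∀ z, g z = 0 → z ∈ Submodule.span 𝕜 (B \ {x}) := by
    intro z hz
    have hmem : z ∈ Submodule.span 𝕜 (b '' {i | i ≠ ⟨x, hxB⟩}) := by
      refine b.mem_span_image.2 fun i hi => ?_
      rintro rfl
      exact (Finsupp.mem_support_iff.1 hi) hz
    refine Submodule.span_mono ?_ hmem
    rintro _ ⟨i, hi, rfl⟩
    have hbi : b i = i := by simp [b]
    rw [hbi]
    exact ⟨i.2, fun h => hi (Subtype.ext h)⟩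
  have hlt : ∀ z, g z = 1 → z ≠ x → 1 < ‖z‖ := by
    intro z hz hzx
    have := hB.norm_lt_norm_add_s10 (hker (z - x) (by simp [hz, hgx])) (sub_ne_zero.2 hzx)
    rwa [add_sub_cancel, hx] at this
  have hbound : ∀ z, ‖g z‖ ≤ 1 * ‖z‖ := by
    intro z
    rw [one_mul]
    by_cases hz : g z = 0
    · simp [hz]
    have hle : 1 ≤ ‖(g z)⁻¹ • z‖ := by
      by_cases h : (g z)⁻¹ • z = x
      · rw [h, hx]
      · exact (hlt _ (by simp [hz]) h).le
    rwa [norm_smul, norm_inv, ← div_eq_inv_mul, one_le_div (norm_pos_iff.2 hz)] at hle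
  refine ⟨hx.le, g.mkContinuous 1 hbound, le_antisymm ?_ ?_, hgx, fun z hz hgz => ?_⟩
  · exact g.mkContinuous_norm_le zero_le_one hbound
  · simpa [hgx, hx] using (g.mkContinuous 1 hbound).le_opNorm x
  · by_contra hzx
    exact (hlt z hgz hzx).not_ge hz

/-- A unit vector `x` is an exposed point of the closed unit ball iff there exists a
Hamel basis of `X` containing `x` which is strongly orthonormal relative to `x` in the
sense of Birkhoff–James. -/
theorem exposedPoint_iff_stronglyOrthonormalBasis
    (𝕜 X : Type*) [RCLike 𝕜] [NormedAddCommGroup X] [NormedSpace 𝕜 X]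
    (x : X) (hx : ‖x‖ = 1) :
    IsExposedPointOfBall 𝕜 x ↔
      ∃ B : Set X, x ∈ B ∧ IsHamelBasis 𝕜 B ∧ IsStronglyOrthonormalRelTo 𝕜 B x := by
  exact ⟨fun h => h.exists_stronglyOrthonormal hx,
    fun ⟨_, hxB, hbasis, hB⟩ => hB.isExposedPointOfBall hxB hbasis⟩
end

section
/- Let X be a normed linear space over the field K (real or complex) and x ∈ X with ‖x‖ = 1. Then x is an exposed point of the closed unit ball B_X if and only if there exists a bounded linear operator A on X which attains its norm at x and attains its norm only at points of the form λ x with λ a scalar of modulus 1. -/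
open scoped BigOperators

section

variable {𝕜 X : Type*} [RCLike 𝕜] [NormedAddCommGroup X] [NormedSpace 𝕜 X]

lemma norm_eq_one_of_apply_eq_one {f : X →L[𝕜] 𝕜} (hf : ‖f‖ ≤ 1) {z : X} (hz : ‖z‖ ≤ 1)
    (hfz : f z = 1) : ‖z‖ = 1 := by
  refine le_antisymm hz ?_
  simpa [hfz] using f.le_of_opNorm_le hf z

/-- An operator attaining its norm at a unit vector `x` admits a norm-one functional `f` with
`f x = 1` such that the operator attains its norm wherever `f` takes the value `1` on the ball. -/
lemma exists_functional_of_norm_attaining {x : X} (hx : ‖x‖ = 1) {A : X →L[𝕜] X}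
    (hA : ‖A x‖ = ‖A‖) :
    ∃ f : X →L[𝕜] 𝕜, ‖f‖ = 1 ∧ f x = 1 ∧ ∀ z : X, ‖z‖ ≤ 1 → f z = 1 → ‖A z‖ = ‖A‖ := by
  rcases eq_or_ne A 0 with rfl | hA0
  · obtain ⟨f, hf, hfx⟩ := exists_dual_vector 𝕜 x (by simp [hx])
    exact ⟨f, hf, by simpa [hx] using hfx, by simp⟩
  have hpos : 0 < ‖A‖ := norm_pos_iff.mpr hA0
  have hne : (‖A‖ : 𝕜) ≠ 0 := by exact_mod_cast hpos.ne'
  obtain ⟨g, hg, hgx⟩ := exists_dual_vector 𝕜 (A x) (hA ▸ hpos.ne')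
  set f : X →L[𝕜] 𝕜 := (‖A‖ : 𝕜)⁻¹ • g.comp A with hf
  have hfx : f x = 1 := by
    simp [hf, hgx, hA, hne]
  have hle : ‖f‖ ≤ 1 := by
    rw [hf, norm_smul, norm_inv, RCLike.norm_ofReal, abs_of_pos hpos, inv_mul_le_one₀ hpos]
    simpa [hg] using g.opNorm_comp_le A
  refine ⟨f, le_antisymm hle ?_, hfx, fun z hz hfz => le_antisymm ?_ ?_⟩
  · simpa [hfx, hx] using f.le_opNorm x
  · exact A.unit_le_opNorm z hz
  · have hgz : g (A z) = (‖A‖ : 𝕜) := by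
      simpa [hf, inv_mul_eq_one₀ hne, eq_comm] using hfz
    simpa [hgz, hg] using g.le_opNorm (A z)

end

/-- A unit vector `x` is an exposed point of the closed unit ball iff there exists a
bounded linear operator `A` on `X` which attains its norm at `x` and attains its norm
only at points of the form `λ x` with `|λ| = 1`. -/
theorem exposedPoint_iff_normAttaining_operator
    (𝕜 X : Type*) [RCLike 𝕜] [NormedAddCommGroup X] [NormedSpace 𝕜 X]
    (x : X) (hx : ‖x‖ = 1) :
    IsExposedPointOfBall 𝕜 x ↔
      ∃ A : X →L[𝕜] X, ‖A x‖ = ‖A‖ ∧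
        ∀ y : X, ‖y‖ = 1 → ‖A y‖ = ‖A‖ → ∃ lam : 𝕜, ‖lam‖ = 1 ∧ y = lam • x := by
  constructor
  · rintro ⟨-, f, hf, hfx, hexp⟩
    refine ⟨f.smulRight x, by simp [hf, hfx, hx], fun y hy hAy => ?_⟩
    have hfy : ‖f y‖ = 1 := by simpa [hf, hx, norm_smul] using hAy
    have hne : f y ≠ 0 := norm_ne_zero_iff.mp (by simp [hfy])
    refine ⟨f y, hfy, ?_⟩
    rw [← hexp ((f y)⁻¹ • y) (by simp [norm_smul, hfy, hy]) (by simp [hne]), smul_inv_smul₀ hne]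
  · rintro ⟨A, hA, hAy⟩
    obtain ⟨f, hf, hfx, hfA⟩ := exists_functional_of_norm_attaining hx hA
    refine ⟨hx.le, f, hf, hfx, fun z hz hfz => ?_⟩
    obtain ⟨lam, -, rfl⟩ := hAy z (norm_eq_one_of_apply_eq_one hf.le hz hfz) (hfA z hz hfz)
    have hlam : lam = 1 := by simpa [hfx] using hfz
    rw [hlam, one_smul]
end

section
/- A normed linear space X over the field K (real or complex) is strictly convex if and only if for each x ∈ X with ‖x‖ = 1 there exists a bounded linear operator A on X which attains its norm at x and attains its norm only at points of the form λ x with λ a scalar of modulus 1. -/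
open scoped BigOperators

theorem eq_and_eq_of_le_convex_combo {a b c t : ℝ} (ht₀ : 0 < t) (ht₁ : t < 1)
    (ha : a ≤ c) (hb : b ≤ c) (h : c ≤ t * a + (1 - t) * b) : a = c ∧ b = c := by
  constructor
  · by_contra hne
    have := lt_of_le_of_ne ha hne
    nlinarith
  · by_contra hne
    have := lt_of_le_of_ne hb hne
    nlinarith

theorem norm_convex_combo_le {𝕜 E : Type*} [RCLike 𝕜] [NormedAddCommGroup E]
    [NormedSpace 𝕜 E] {t : ℝ} (ht₀ : 0 < t) (ht₁ : t < 1) (u v : E) :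
    ‖(t : 𝕜) • u + ((1 - t : ℝ) : 𝕜) • v‖ ≤ t * ‖u‖ + (1 - t) * ‖v‖ := by
  refine (norm_add_le _ _).trans_eq ?_
  rw [norm_smul, norm_smul, RCLike.norm_of_nonneg ht₀.le, RCLike.norm_of_nonneg (by linarith)]

theorem RCLike.eq_one_and_eq_one_of_convex_combo_eq_one {𝕜 : Type*} [RCLike 𝕜] {a b : 𝕜} {t : ℝ}
    (ht₀ : 0 < t) (ht₁ : t < 1) (ha : ‖a‖ = 1) (hb : ‖b‖ = 1)
    (h : (t : 𝕜) * a + ((1 - t : ℝ) : 𝕜) * b = 1) : a = 1 ∧ b = 1 := by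
  have hre := congrArg RCLike.re h
  rw [map_add, RCLike.re_ofReal_mul, RCLike.re_ofReal_mul, RCLike.one_re] at hre
  obtain ⟨h₁, h₂⟩ := eq_and_eq_of_le_convex_combo ht₀ ht₁ (ha ▸ RCLike.re_le_norm a)
    (hb ▸ RCLike.re_le_norm b) hre.ge
  have key : ∀ c : 𝕜, ‖c‖ = 1 → RCLike.re c = 1 → c = 1 := fun c hc hrec => by
    rw [← RCLike.re_eq_self_of_le (hc.trans hrec.symm).le, hrec, RCLike.ofReal_one]
  exact ⟨key a ha h₁, key b hb h₂⟩

theorem IsStrictlyConvexSpace.eq_of_dual_eq_one {𝕜 X : Type*} [RCLike 𝕜] [NormedAddCommGroup X]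
    [NormedSpace 𝕜 X] (hX : IsStrictlyConvexSpace 𝕜 X) {f : X →L[𝕜] 𝕜} (hf : ‖f‖ = 1) {x z : X}
    (hx : ‖x‖ = 1) (hz : ‖z‖ = 1) (hfx : f x = 1) (hfz : f z = 1) : z = x := by
  set w : X := ((1 / 2 : ℝ) : 𝕜) • x + ((1 - 1 / 2 : ℝ) : 𝕜) • z with hw
  have hfw : f w = 1 := by
    rw [hw, map_add, map_smul, map_smul, hfx, hfz, smul_eq_mul, smul_eq_mul, mul_one, mul_one,
      ← RCLike.ofReal_add]
    norm_num
  have hw_norm : ‖w‖ = 1 := by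
    apply le_antisymm
    · have := norm_convex_combo_le (𝕜 := 𝕜) (t := 1 / 2) (by norm_num) (by norm_num) x z
      rw [← hw, hx, hz] at this
      linarith
    · simpa [hfw, hf] using f.le_opNorm w
  obtain ⟨h₁, h₂⟩ := (hX w hw_norm).2 x z hx.le hz.le (1 / 2) (by norm_num) (by norm_num) hw
  rw [h₁, h₂]

/-- A normed linear space is strictly convex iff for each unit vector `x` there exists a
bounded linear operator `A` on `X` which attains its norm at `x` and attains its norm
only at points of the form `λ x` with `|λ| = 1`. -/
theorem strictlyConvex_iff_normAttaining_operator
    (𝕜 X : Type*) [RCLike 𝕜] [NormedAddCommGroup X] [NormedSpace 𝕜 X] :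
    IsStrictlyConvexSpace 𝕜 X ↔
      ∀ x : X, ‖x‖ = 1 →
        ∃ A : X →L[𝕜] X, ‖A x‖ = ‖A‖ ∧
          ∀ y : X, ‖y‖ = 1 → ‖A y‖ = ‖A‖ → ∃ lam : 𝕜, ‖lam‖ = 1 ∧ y = lam • x := by
  constructor
  · intro hX x hx
    obtain ⟨f, hf, hfx⟩ := exists_dual_vector 𝕜 x (by simp [hx])
    rw [hx, RCLike.ofReal_one] at hfx
    have hA : ‖f.smulRight x‖ = 1 := by rw [ContinuousLinearMap.norm_smulRight_apply,
      hf, hx, one_mul]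
    refine ⟨f.smulRight x, by simp [hA, hfx, hx], fun y hy hAy => ?_⟩
    have hfy : ‖f y‖ = 1 := by simpa [hA, norm_smul, hx] using hAy
    have hne : f y ≠ 0 := norm_ne_zero_iff.mp (by simp [hfy])
    refine ⟨f y, hfy, ?_⟩
    have hz : (f y)⁻¹ • y = x := hX.eq_of_dual_eq_one hf hx
      (by rw [norm_smul, norm_inv, hfy, hy, inv_one, one_mul]) hfx
      (by rw [map_smul, smul_eq_mul, inv_mul_cancel₀ hne])
    rw [← hz, smul_inv_smul₀ hne]
  · refine fun h x hx => ⟨hx.le, fun z₁ z₂ hz₁ hz₂ t ht₀ ht₁ hxz => ?_⟩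
    obtain ⟨A, hAx, hA⟩ := h x hx
    obtain ⟨hn₁, hn₂⟩ := eq_and_eq_of_le_convex_combo ht₀ ht₁ hz₁ hz₂
      (hx.ge.trans (hxz ▸ norm_convex_combo_le ht₀ ht₁ z₁ z₂))
    obtain ⟨hA₁, hA₂⟩ := eq_and_eq_of_le_convex_combo ht₀ ht₁
      (A.unit_le_opNorm z₁ hz₁) (A.unit_le_opNorm z₂ hz₂)
      (by rw [← hAx, hxz, map_add, map_smul, map_smul]
          exact norm_convex_combo_le ht₀ ht₁ (A z₁) (A z₂))
    obtain ⟨a, ha, rfl⟩ := hA z₁ hn₁ hA₁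
    obtain ⟨b, hb, rfl⟩ := hA z₂ hn₂ hA₂
    have hx₀ : x ≠ 0 := norm_ne_zero_iff.mp (by simp [hx])
    have hab : (t : 𝕜) * a + ((1 - t : ℝ) : 𝕜) * b = 1 := by
      apply smul_left_injective 𝕜 hx₀
      simpa only [add_smul, mul_smul, one_smul] using hxz.symm
    obtain ⟨rfl, rfl⟩ := RCLike.eq_one_and_eq_one_of_convex_combo_eq_one ht₀ ht₁ ha hb hab
    simp
end

section
/- A normed linear space X over the field K (real or complex) is strictly convex if and only if every element of the unit sphere S_X = {x : ‖x‖ = 1} is an exposed point of the closed unit ball B_X = {x : ‖x‖ ≤ 1}. -/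
open scoped BigOperators

/-- A functional of norm one sends the closed unit ball into the closed unit ball. -/
theorem norm_apply_le_one_of_norm_eq_one {𝕜 X : Type*} [RCLike 𝕜] [NormedAddCommGroup X]
    [NormedSpace 𝕜 X] {f : X →L[𝕜] 𝕜} (hf : ‖f‖ = 1) {z : X} (hz : ‖z‖ ≤ 1) : ‖f z‖ ≤ 1 := by
  simpa [hf] using f.le_opNorm_of_le hz

/-- A scalar in the closed unit disc with real part at least one equals one. -/
theorem RCLike.eq_one_of_norm_le_one_of_one_le_re {𝕜 : Type*} [RCLike 𝕜] {w : 𝕜}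
    (hw : ‖w‖ ≤ 1) (hre : 1 ≤ RCLike.re w) : w = 1 := by
  have hsq : RCLike.re w * RCLike.re w + RCLike.im w * RCLike.im w ≤ 1 := by
    rw [← RCLike.normSq_apply, RCLike.normSq_eq_def']
    exact pow_le_one₀ (norm_nonneg w) hw
  apply RCLike.ext
  · rw [RCLike.one_re]
    nlinarith [mul_self_nonneg (RCLike.im w)]
  · rw [RCLike.one_im]
    exact mul_self_eq_zero.mp (by nlinarith [mul_self_nonneg (RCLike.im w)])

/-- An exposed point of the closed unit ball is an extreme point of it. -/
theorem IsExposedPointOfBall.isExtremePointOfBall {𝕜 X : Type*} [RCLike 𝕜]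
    [NormedAddCommGroup X] [NormedSpace 𝕜 X] {x : X} (hx : IsExposedPointOfBall 𝕜 x) :
    IsExtremePointOfBall 𝕜 x := by
  obtain ⟨hx1, f, hf, hfx, hexp⟩ := hx
  refine ⟨hx1, fun z₁ z₂ hz₁ hz₂ t ht0 ht1 hxz => ?_⟩
  have h₁ := norm_apply_le_one_of_norm_eq_one hf hz₁
  have h₂ := norm_apply_le_one_of_norm_eq_one hf hz₂
  have hr₁ := (RCLike.re_le_norm (f z₁)).trans h₁
  have hr₂ := (RCLike.re_le_norm (f z₂)).trans h₂
  have hre : 1 = t * RCLike.re (f z₁) + (1 - t) * RCLike.re (f z₂) := by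
    have h : (1 : 𝕜) = (t : 𝕜) * f z₁ + ((1 - t : ℝ) : 𝕜) * f z₂ := by
      simpa only [hfx, map_add, map_smul, smul_eq_mul] using congrArg f hxz
    simpa only [RCLike.one_re, map_add, RCLike.re_ofReal_mul] using congrArg RCLike.re h
  exact ⟨hexp z₁ hz₁ (RCLike.eq_one_of_norm_le_one_of_one_le_re h₁ (by nlinarith)),
    hexp z₂ hz₂ (RCLike.eq_one_of_norm_le_one_of_one_le_re h₂ (by nlinarith))⟩

/-- In a strictly convex space, every point of the unit sphere is an exposed point of the
closed unit ball. -/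
theorem IsStrictlyConvexSpace.isExposedPointOfBall {𝕜 X : Type*} [RCLike 𝕜]
    [NormedAddCommGroup X] [NormedSpace 𝕜 X] (h : IsStrictlyConvexSpace 𝕜 X) {x : X}
    (hx : ‖x‖ = 1) : IsExposedPointOfBall 𝕜 x := by
  obtain ⟨f, hf, hfx⟩ := exists_dual_vector 𝕜 x (by simp [hx])
  have hfx1 : f x = 1 := by simpa [hx] using hfx
  refine ⟨hx.le, f, hf, hfx1, fun z hz hfz => ?_⟩
  let t : ℝ := 1 / 2
  set m : X := (t : 𝕜) • x + ((1 - t : ℝ) : 𝕜) • z with hm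
  have hfm : f m = 1 := by
    simp only [hm, map_add, map_smul, hfx1, hfz, smul_eq_mul, mul_one]
    rw [← RCLike.ofReal_add, add_sub_cancel, RCLike.ofReal_one]
  have hm_ge : 1 ≤ ‖m‖ := by simpa [hfm, hf] using f.le_opNorm m
  have hm_le : ‖m‖ ≤ 1 := by
    calc ‖m‖ ≤ ‖(t : 𝕜) • x‖ + ‖((1 - t : ℝ) : 𝕜) • z‖ := norm_add_le _ _
      _ = 1 / 2 * ‖x‖ + 1 / 2 * ‖z‖ := by
        rw [norm_smul, norm_smul, RCLike.norm_ofReal, RCLike.norm_ofReal]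
        norm_num [t]
      _ ≤ 1 := by linarith
  obtain ⟨hxm, hzm⟩ := (h m (hm_le.antisymm hm_ge)).2 x z hx.le hz t (by norm_num [t])
    (by norm_num [t]) hm
  exact hzm.trans hxm.symm

/-- A normed linear space is strictly convex iff every element of the unit sphere is an
exposed point of the closed unit ball. -/
theorem strictlyConvex_iff_forall_exposedPoint
    (𝕜 X : Type*) [RCLike 𝕜] [NormedAddCommGroup X] [NormedSpace 𝕜 X] :
    IsStrictlyConvexSpace 𝕜 X ↔ ∀ x : X, ‖x‖ = 1 → IsExposedPointOfBall 𝕜 x := by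
  exact ⟨fun h _ hx => h.isExposedPointOfBall hx, fun h x hx => (h x hx).isExtremePointOfBall⟩
end

section
/- Let X be a normed linear space, let {x₀} ∪ {x_α : α ∈ Λ} be a Hamel basis of X which is strongly orthonormal relative to x₀ in the sense of Birkhoff–James, and let z = β₀ x₀ + Σ_{j=1}^{n} βⱼ x_{αⱼ} with ‖z‖ = 1, where α₁, …, αₙ are distinct elements of Λ. Then |β₀| ≤ 1; moreover, if |β₀| = 1 then βⱼ = 0 for all j = 1, …, n, so that z = β₀ x₀. -/
open scoped BigOperators

/-- If `x₀ ∈ B` and `B` is strongly orthonormal relative to `x₀`, then a linear combination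
with nonzero `x₀`-coefficient `a` and some other nonzero coefficient has norm larger than `‖a‖`. -/
theorem IsStronglyOrthonormalRelTo.norm_coeff_lt {𝕜 X : Type*} [RCLike 𝕜] [NormedAddCommGroup X]
    [NormedSpace 𝕜 X] {B : Set X} {x₀ : X} (h : IsStronglyOrthonormalRelTo 𝕜 B x₀)
    (hx₀ : x₀ ∈ B) {s : Finset X} (hs : (s : Set X) ⊆ B \ {x₀}) {a : 𝕜} (ha : a ≠ 0) {c : X → 𝕜}
    (hc : ∃ y ∈ s, c y ≠ 0) : ‖a‖ < ‖a • x₀ + ∑ y ∈ s, c y • y‖ := by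
  obtain ⟨y, hy, hcy⟩ := hc
  have hlt := h.2 s (fun y => a⁻¹ * c y) hs ⟨y, hy, mul_ne_zero (inv_ne_zero ha) hcy⟩
  have hfactor : a • x₀ + ∑ y ∈ s, c y • y = a • (x₀ + ∑ y ∈ s, (a⁻¹ * c y) • y) := by
    simp only [smul_add, Finset.smul_sum, smul_smul, mul_inv_cancel_left₀ ha]
  rw [h.1 x₀ hx₀] at hlt
  rw [hfactor, norm_smul]
  exact lt_mul_of_one_lt_right (norm_pos_iff.mpr ha) hlt

/-- If `{x₀} ∪ {x_α}` is a Hamel basis of `X` strongly orthonormal relative to `x₀` in the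
sense of Birkhoff–James and `z = β₀ x₀ + ∑ⱼ βⱼ x_{αⱼ}` is a unit vector, then `|β₀| ≤ 1`;
moreover, if `|β₀| = 1` then all `βⱼ = 0`, so that `z = β₀ x₀`. -/
theorem coeff_le_one_of_stronglyOrthonormalBasis
    (𝕜 X : Type*) [RCLike 𝕜] [NormedAddCommGroup X] [NormedSpace 𝕜 X]
    (x₀ : X) (B : Set X) (hx₀B : x₀ ∈ B)
    (hB : IsHamelBasis 𝕜 B) (hso : IsStronglyOrthonormalRelTo 𝕜 B x₀)
    (s : Finset X) (hs : (s : Set X) ⊆ B \ {x₀})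
    (β₀ : 𝕜) (β : X → 𝕜) (z : X)
    (hz : z = β₀ • x₀ + ∑ y ∈ s, β y • y) (hz1 : ‖z‖ = 1) :
    ‖β₀‖ ≤ 1 ∧ (‖β₀‖ = 1 → (∀ y ∈ s, β y = 0) ∧ z = β₀ • x₀) := by
  by_cases hβ : ∃ y ∈ s, β y ≠ 0
  · have hlt : ‖β₀‖ < 1 := by
      by_cases h0 : β₀ = 0
      · simp [h0]
      · rw [← hz1, hz]
        exact hso.norm_coeff_lt hx₀B hs h0 hβ
    exact ⟨hlt.le, fun h => absurd h hlt.ne⟩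
  · push Not at hβ
    have hz' : z = β₀ • x₀ := by
      rw [hz, Finset.sum_eq_zero fun y hy => by rw [hβ y hy, zero_smul], add_zero]
    have hnorm : ‖β₀‖ = 1 := by
      rw [← hz1, hz', norm_smul, hso.1 x₀ hx₀B, mul_one]
    exact ⟨hnorm.le, fun _ => ⟨hβ, hz'⟩⟩
end

section
/- In ℝⁿ equipped with the ℓ_p norm, where 1 < p < ∞, the notions of Birkhoff–James orthogonality and strong Birkhoff–James orthogonality coincide for nonzero vectors: if x, y ∈ ℝⁿ are nonzero and ‖x‖_p ≤ ‖x + λ y‖_p for all real λ, then ‖x‖_p < ‖x + λ y‖_p for all real λ ≠ 0. -/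
open scoped ENNReal

/-- For `1 < p`, the function `t ↦ |t| ^ p` is strictly midpoint convex on `ℝ`. -/
theorem abs_midpoint_rpow_lt {p : ℝ} (hp : 1 < p) {a b : ℝ} (hab : a ≠ b) :
    |(a + b) / 2| ^ p < (|a| ^ p + |b| ^ p) / 2 := by
  have hp0 : 0 < p := zero_lt_one.trans hp
  by_cases habs : |a| = |b|
  · obtain rfl : a = -b := (abs_eq_abs.mp habs).resolve_left hab
    have hb : b ≠ 0 := by
      rintro rfl
      simp at hab
    have hpos : 0 < |b| ^ p := Real.rpow_pos_of_pos (abs_pos.mpr hb) p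
    simpa [Real.zero_rpow hp0.ne'] using hpos
  · have hconv := (strictConvexOn_rpow hp).2 (abs_nonneg a) (abs_nonneg b) habs
      (by norm_num : (0 : ℝ) < 1 / 2) (by norm_num : (0 : ℝ) < 1 / 2) (by norm_num)
    simp only [smul_eq_mul] at hconv
    have htri : |(a + b) / 2| ≤ 1 / 2 * |a| + 1 / 2 * |b| := by
      rw [abs_div, abs_two]
      linarith [abs_add_le a b]
    have hmono := Real.rpow_le_rpow (abs_nonneg _) htri hp0.le
    linarith

/-- For `1 < p < ∞`, the `p`-th power of the `ℓ_p` norm is strictly midpoint convex. -/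
theorem PiLp.norm_midpoint_rpow_lt {ι : Type*} [Fintype ι] {p : ℝ≥0∞} [Fact (1 ≤ p)]
    (hp : 1 < p) (hp' : p ≠ ∞) {x z : PiLp p (fun _ : ι => ℝ)} (hxz : x ≠ z) :
    ‖(1 / 2 : ℝ) • (x + z)‖ ^ p.toReal < (‖x‖ ^ p.toReal + ‖z‖ ^ p.toReal) / 2 := by
  have hp1 : 1 < p.toReal := by
    simpa using (ENNReal.toReal_lt_toReal ENNReal.one_ne_top hp').mpr hp
  have hp0 : 0 < p.toReal := zero_lt_one.trans hp1
  have norm_rpow (v : PiLp p (fun _ : ι => ℝ)) :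
      ‖v‖ ^ p.toReal = ∑ i, |v i| ^ p.toReal := by
    rw [PiLp.norm_eq_sum hp0, one_div, Real.rpow_inv_rpow _ hp0.ne']
    · simp only [Real.norm_eq_abs]
    · positivity
  have hcoord (i : ι) : ((1 / 2 : ℝ) • (x + z)) i = (x i + z i) / 2 := by
    simp only [PiLp.smul_apply, PiLp.add_apply, smul_eq_mul]
    ring
  obtain ⟨j, hj⟩ : ∃ j, x j ≠ z j := by
    by_contra! hall
    exact hxz (PiLp.ext hall)
  simp only [norm_rpow, hcoord]
  rw [← Finset.sum_add_distrib, Finset.sum_div]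
  refine Finset.sum_lt_sum (fun i _ => ?_) ⟨j, Finset.mem_univ j, abs_midpoint_rpow_lt hp1 hj⟩
  by_cases hi : x i = z i
  · simp [hi]
  · exact (abs_midpoint_rpow_lt hp1 hi).le

/-- In `ℝⁿ` with the `ℓ_p` norm (`1 < p < ∞`), Birkhoff–James orthogonality and strong
Birkhoff–James orthogonality coincide for nonzero vectors. -/
theorem lp_orthogonal_iff_strong (n : ℕ) (p : ℝ≥0∞) [Fact (1 ≤ p)]
    (hp : 1 < p) (hp' : p ≠ ∞)
    (x y : PiLp p (fun _ : Fin n => ℝ)) (hx : x ≠ 0) (hy : y ≠ 0)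
    (h : ∀ lam : ℝ, ‖x‖ ≤ ‖x + lam • y‖) :
    ∀ lam : ℝ, lam ≠ 0 → ‖x‖ < ‖x + lam • y‖ := by
  intro lam hlam
  by_contra! hle
  have hne : x ≠ x + lam • y := by
    simpa using And.intro hlam hy
  have hmid := PiLp.norm_midpoint_rpow_lt hp hp' hne
  have heq : (1 / 2 : ℝ) • (x + (x + lam • y)) = x + (lam / 2) • y := by
    module
  rw [heq] at hmid
  have hlower := Real.rpow_le_rpow (norm_nonneg x) (h (lam / 2)) p.toReal_nonneg
  have hupper := Real.rpow_le_rpow (norm_nonneg _) hle p.toReal_nonneg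
  linarith
end
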